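/- arXiv:1905.00340 — 3 statements merged into one kernel-verified Lean document; each statement's English description precedes it below -/
import Mathlib

section
/- Let G be a finite simple graph, k an integer, M a module of G, and S, T independent sets of G with S ∩ M = T ∩ M = ∅. Let A be a maximum independent set of the induced subgraph G[M]. Then for every vertex u ∈ M ∖ A, S ↭_k T in G if and only if S ↭_k T in G − u. -/
open Finset

variable {V : Type*}

/-- `S` is an independent set of the simple graph `G`. -/
def IndepF (G : SimpleGraph V) (S : Finset V) : Prop :=
  ∀ u ∈ S, ∀ v ∈ S, ¬ G.Adj u v

/-- A single `TAR_k` step inside the induced subgraph `G[W]`: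
both sets are independent sets of `G` contained in `W`, their symmetric
difference has at most one element, and both have size at least `k`. -/
def TarStepOn [DecidableEq V] (G : SimpleGraph V) (W : Set V) (k : ℤ)
    (A B : Finset V) : Prop :=
  (A : Set V) ⊆ W ∧ (B : Set V) ⊆ W ∧ IndepF G A ∧ IndepF G B ∧
    (symmDiff A B).card ≤ 1 ∧ k ≤ (A.card : ℤ) ∧ k ≤ (B.card : ℤ)

/-- `TAR_k` reachability inside the induced subgraph `G[W]`. -/
def TarReachOn [DecidableEq V] (G : SimpleGraph V) (W : Set V) (k : ℤ) :
    Finset V → Finset V → Prop :=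
  Relation.ReflTransGen (TarStepOn G W k)

/-- A single token-sliding step inside the induced subgraph `G[W]`. -/
def TsStepOn [DecidableEq V] (G : SimpleGraph V) (W : Set V) (A B : Finset V) : Prop :=
  (A : Set V) ⊆ W ∧ (B : Set V) ⊆ W ∧ IndepF G A ∧ IndepF G B ∧
    ∃ x y, G.Adj x y ∧ symmDiff A B = {x, y}

/-- Token-sliding (`TS`) reachability inside the induced subgraph `G[W]`. -/
def TsReachOn [DecidableEq V] (G : SimpleGraph V) (W : Set V) :
    Finset V → Finset V → Prop :=
  Relation.ReflTransGen (TsStepOn G W)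

/-- `M` is a module of `G`. -/
def IsModule [DecidableEq V] (G : SimpleGraph V) (M : Finset V) : Prop :=
  ∀ u ∈ M, ∀ v ∈ M, ∀ w, w ∉ M → (G.Adj u w ↔ G.Adj v w)

/-- The open neighborhood `N(M)` of the vertex set `M`: vertices outside `M`
adjacent to some vertex of `M`. -/
def NbhdSet (G : SimpleGraph V) (M : Finset V) : Set V :=
  {w | w ∉ M ∧ ∃ v ∈ M, G.Adj v w}

/-- `lam G W S k` : the largest size of an independent set reachable from `S`
under `TAR_k` inside the induced subgraph `G[W]`. -/
noncomputable def lam [DecidableEq V] (G : SimpleGraph V) (W : Set V)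
    (S : Finset V) (k : ℤ) : ℕ :=
  sSup {n | ∃ T : Finset V, TarReachOn G W k S T ∧ T.card = n}

/-- A single token-jumping step: both sets are independent, of equal size,
and their symmetric difference has exactly two elements. -/
def TjStep [DecidableEq V] (G : SimpleGraph V) (A B : Finset V) : Prop :=
  IndepF G A ∧ IndepF G B ∧ A.card = B.card ∧ (symmDiff A B).card = 2

/-- Token-jumping (`TJ`) reachability. -/
def TjReach [DecidableEq V] (G : SimpleGraph V) : Finset V → Finset V → Prop :=
  Relation.ReflTransGen (TjStep G)

theorem IndepF.mono {G : SimpleGraph V} {P Q : Finset V} (hQ : IndepF G Q) (h : P ⊆ Q) :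
    IndepF G P :=
  fun a ha b hb => hQ a (h ha) b (h hb)

theorem TarStepOn.symm [DecidableEq V] {G : SimpleGraph V} {W : Set V} {k : ℤ}
    {P Q : Finset V} (h : TarStepOn G W k P Q) : TarStepOn G W k Q P := by
  obtain ⟨hP, hQ, iP, iQ, hd, kP, kQ⟩ := h
  exact ⟨hQ, hP, iQ, iP, by rwa [symmDiff_comm], kQ, kP⟩

theorem TarReachOn.symm [DecidableEq V] {G : SimpleGraph V} {W : Set V} {k : ℤ}
    {P Q : Finset V} (h : TarReachOn G W k P Q) : TarReachOn G W k Q P :=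
  by
  have : Std.Symm (TarStepOn G W k) := ⟨fun _ _ h => h.symm⟩
  exact Relation.ReflTransGen.stdSymm.symm _ _ h

theorem TarReachOn.mono [DecidableEq V] {G : SimpleGraph V} {W W' : Set V} {k : ℤ}
    {P Q : Finset V} (hW : W ⊆ W') (h : TarReachOn G W k P Q) : TarReachOn G W' k P Q :=
  Relation.ReflTransGen.mono
    (fun _ _ h => ⟨h.1.trans hW, h.2.1.trans hW, h.2.2⟩) _ _ h

/-- The two sets of a `TAR_k` step are nested. -/
theorem TarStepOn.subset_or_subset [DecidableEq V] {G : SimpleGraph V} {W : Set V} {k : ℤ}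
    {P Q : Finset V} (h : TarStepOn G W k P Q) : P ⊆ Q ∨ Q ⊆ P := by
  by_contra! hne
  obtain ⟨x, hxP, hxQ⟩ := not_subset.mp hne.1
  obtain ⟨y, hyQ, hyP⟩ := not_subset.mp hne.2
  have hxy := card_le_one.mp h.2.2.2.2.1 x (by simp [mem_symmDiff, hxP, hxQ])
    y (by simp [mem_symmDiff, hyP, hyQ])
  exact hxQ (hxy ▸ hyQ)

/-- A subset of an independent set reaches it by adding the missing vertices one by one. -/
theorem tarReachOn_of_subset [DecidableEq V] {G : SimpleGraph V} {W : Set V} {k : ℤ}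
    {P Q : Finset V} (hPQ : P ⊆ Q) (hQW : (Q : Set V) ⊆ W) (hQ : IndepF G Q)
    (hk : k ≤ (P.card : ℤ)) : TarReachOn G W k P Q := by
  induction Q using Finset.strongInduction with
  | H Q ih =>
    obtain rfl | hss := hPQ.eq_or_ssubset
    · exact Relation.ReflTransGen.refl
    obtain ⟨x, hxQ, hxP⟩ := exists_of_ssubset hss
    have hPe : P ⊆ Q.erase x := subset_erase.mpr ⟨hPQ, hxP⟩
    have hsub := erase_subset x Q
    have hWe : (Q.erase x : Set V) ⊆ W := (coe_subset.mpr hsub).trans hQW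
    have hd : symmDiff (Q.erase x) Q ⊆ {x} := by
      intro y
      simp only [mem_symmDiff, mem_erase, mem_singleton]
      tauto
    have hc := card_le_card hPe
    have hc' := card_le_card hPQ
    exact (ih _ (erase_ssubset hxQ) hPe hWe (hQ.mono hsub)).tail
      ⟨hWe, hQW, hQ.mono hsub, hQ, by simpa using card_le_card hd, by omega, by omega⟩

/-- Replace the part of `X` inside `M`, if there is any, by `A`. -/
def swapPart [DecidableEq V] (M A X : Finset V) : Finset V :=
  if X ∩ M = ∅ then X else X \ M ∪ A

theorem swapPart_mono [DecidableEq V] {M A X Y : Finset V} (h : X ⊆ Y) :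
    swapPart M A X ⊆ swapPart M A Y := by
  unfold swapPart
  split_ifs with hX hY hY
  · exact h
  · intro x hx
    have hxM : x ∉ M := fun hxM => by simpa [hX] using mem_inter.mpr ⟨hx, hxM⟩
    exact mem_union_left _ (mem_sdiff.mpr ⟨h hx, hxM⟩)
  · exact absurd (subset_empty.mp (hY ▸ inter_subset_inter_right h)) hX
  · exact union_subset_union_left (sdiff_subset_sdiff h (Subset.refl M))

theorem subset_compl_swapPart [DecidableEq V] {M A X : Finset V} {u : V} (huM : u ∈ M)
    (huA : u ∉ A) : (swapPart M A X : Set V) ⊆ {u}ᶜ := by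
  rw [Set.subset_compl_singleton_iff, mem_coe]
  unfold swapPart
  split_ifs with hX
  · exact fun hu => by simpa [hX] using mem_inter.mpr ⟨hu, huM⟩
  · simp [huM, huA]

theorem card_le_card_swapPart [DecidableEq V] {G : SimpleGraph V} {M A X : Finset V}
    (hAM : A ⊆ M) (hAmax : ∀ B : Finset V, B ⊆ M → IndepF G B → B.card ≤ A.card)
    (hX : IndepF G X) : X.card ≤ (swapPart M A X).card := by
  unfold swapPart
  split_ifs with h
  · exact le_rfl
  · rw [card_union_of_disjoint (disjoint_sdiff_self_left.mono_right hAM),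
      ← card_sdiff_add_card_inter X M]
    exact Nat.add_le_add_left (hAmax _ inter_subset_right (hX.mono inter_subset_left)) _

theorem IndepF.swapPart [DecidableEq V] {G : SimpleGraph V} {M A X : Finset V}
    (hM : IsModule G M) (hAM : A ⊆ M) (hA : IndepF G A) (hX : IndepF G X) :
    IndepF G (swapPart M A X) := by
  unfold _root_.swapPart
  split_ifs with h
  · exact hX
  obtain ⟨v, hv⟩ := nonempty_iff_ne_empty.mpr h
  rw [mem_inter] at hv
  have hcross : ∀ a ∈ A, ∀ b ∈ X \ M, ¬ G.Adj a b := fun a ha b hb hab =>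
    hX v hv.1 b (mem_sdiff.mp hb).1
      ((hM a (hAM ha) v hv.2 b (mem_sdiff.mp hb).2).mp hab)
  intro a ha b hb hab
  rcases mem_union.mp ha with ha | ha <;> rcases mem_union.mp hb with hb | hb
  · exact hX a (mem_sdiff.mp ha).1 b (mem_sdiff.mp hb).1 hab
  · exact hcross b hb a ha hab.symm
  · exact hcross a ha b hb hab
  · exact hA a ha b hb hab

/-- Let `G` be a finite simple graph, `k` an integer, `M` a
module of `G`, and `S, T` independent sets of `G` with `S ∩ M = T ∩ M = ∅`.
Let `A` be a maximum independent set of `G[M]`. Then for every `u ∈ M \ A`,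
`S ↭_k T` in `G` if and only if `S ↭_k T` in `G - u`. -/
theorem stmt5 {V : Type*} [Fintype V] [DecidableEq V] (G : SimpleGraph V)
    (k : ℤ) (M : Finset V) (hM : IsModule G M)
    (S T : Finset V) (hS : IndepF G S) (hT : IndepF G T)
    (hSM : S ∩ M = ∅) (hTM : T ∩ M = ∅)
    (A : Finset V) (hAM : A ⊆ M) (hAind : IndepF G A)
    (hAmax : ∀ B : Finset V, B ⊆ M → IndepF G B → B.card ≤ A.card)
    (u : V) (huM : u ∈ M) (huA : u ∉ A) :
    TarReachOn G Set.univ k S T ↔ TarReachOn G ({u}ᶜ : Set V) k S T := by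
  refine ⟨fun h => ?_, TarReachOn.mono (Set.subset_univ _)⟩
  have nested : ∀ X Y : Finset V, X ⊆ Y → IndepF G X → IndepF G Y → k ≤ (X.card : ℤ) →
      TarReachOn G ({u}ᶜ : Set V) k (swapPart M A X) (swapPart M A Y) := by
    intro X Y hXY hX hY hk
    refine tarReachOn_of_subset (swapPart_mono hXY) (subset_compl_swapPart huM huA)
      (IndepF.swapPart hM hAM hAind hY) (hk.trans ?_)
    exact_mod_cast card_le_card_swapPart hAM hAmax hX
  have step : ∀ X Y : Finset V, TarStepOn G Set.univ k X Y →
      TarReachOn G ({u}ᶜ : Set V) k (swapPart M A X) (swapPart M A Y) := by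
    intro X Y hXY
    have hsub := hXY.subset_or_subset
    obtain ⟨-, -, hX, hY, -, kX, kY⟩ := hXY
    exact hsub.elim (fun hs => nested X Y hs hX hY kX)
      (fun hs => (nested Y X hs hY hX kY).symm)
  have key : TarReachOn G ({u}ᶜ : Set V) k (swapPart M A S) (swapPart M A T) :=
    Relation.ReflTransGen.lift' (swapPart M A) step _ _ h
  simpa only [swapPart, hSM, hTM, if_true] using key
end

section
/- Let G be a finite simple graph, M a module of G, k an integer, and S an independent set of G with S ∩ M ≠ ∅. Let H = G − N(M) be the induced subgraph obtained by deleting all vertices outside M that have a neighbor in M. If there exists an independent set T of G with T ∩ M = ∅ and S ↭_k T in G, then there exists an independent set T' of H with T' ∩ M = ∅ and S ↭_k T' in H. -/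
open Finset

variable {V : Type*}

/-- An independent set meeting a module `M` avoids the neighborhood of `M`. -/
theorem IndepF.subset_compl_nbhdSet {V : Type*} [DecidableEq V] {G : SimpleGraph V}
    {M A : Finset V} (hM : IsModule G M) (hA : IndepF G A) (hAM : A ∩ M ≠ ∅) :
    (A : Set V) ⊆ (NbhdSet G M)ᶜ := by
  obtain ⟨u, hu⟩ := Finset.nonempty_iff_ne_empty.mpr hAM
  rw [Finset.mem_inter] at hu
  rintro w hw ⟨hwM, v, hv, hvw⟩
  exact hA u hu.1 w hw ((hM v hv u hu.2 w hwM).mp hvw)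

/-- If `A` has an element outside `B` and the two sets differ in at most one element,
then `B ⊆ A`. -/
theorem subset_of_card_symmDiff_le_one {V : Type*} [DecidableEq V] {A B : Finset V} {x : V}
    (hxA : x ∈ A) (hxB : x ∉ B) (h : (symmDiff A B).card ≤ 1) : B ⊆ A := by
  intro y hyB
  by_contra hyA
  have hxy : x = y := Finset.card_le_one.mp h x
    (Finset.mem_symmDiff.mpr (Or.inl ⟨hxA, hxB⟩)) y
    (Finset.mem_symmDiff.mpr (Or.inr ⟨hyB, hyA⟩))
  exact hxB (hxy ▸ hyB)

/-- Let `G` be a finite simple graph, `M` a module of `G`, `k`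
an integer, and `S` an independent set of `G` with `S ∩ M ≠ ∅`. Let
`H = G - N(M)`. If there exists an independent set `T` of `G` with
`T ∩ M = ∅` and `S ↭_k T` in `G`, then there exists an independent set `T'`
of `H` with `T' ∩ M = ∅` and `S ↭_k T'` in `H`. -/
theorem stmt12 {V : Type*} [Fintype V] [DecidableEq V] (G : SimpleGraph V)
    (M : Finset V) (hM : IsModule G M) (k : ℤ)
    (S : Finset V) (hS : IndepF G S) (hSM : S ∩ M ≠ ∅)
    (T : Finset V) (hT : IndepF G T) (hTM : T ∩ M = ∅)
    (hreach : TarReachOn G Set.univ k S T) :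
    ∃ T' : Finset V, IndepF G T' ∧ (T' : Set V) ⊆ (NbhdSet G M)ᶜ ∧
      T' ∩ M = ∅ ∧ TarReachOn G (NbhdSet G M)ᶜ k S T' := by
  clear hS
  induction hreach using Relation.ReflTransGen.head_induction_on with
  | refl => exact absurd hTM hSM
  | @head A B hAB _ ih =>
    obtain ⟨-, -, hA, hB, hd, hkA, hkB⟩ := hAB
    have hAW := hA.subset_compl_nbhdSet hM hSM
    by_cases hBM : B ∩ M = ∅
    · obtain ⟨x, hx⟩ := Finset.nonempty_iff_ne_empty.mpr hSM
      rw [Finset.mem_inter] at hx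
      have hxB : x ∉ B := fun h =>
        Finset.notMem_empty x (hBM ▸ Finset.mem_inter.mpr ⟨h, hx.2⟩)
      have hBW : (B : Set V) ⊆ (NbhdSet G M)ᶜ :=
        (Finset.coe_subset.mpr (subset_of_card_symmDiff_le_one hx.1 hxB hd)).trans hAW
      exact ⟨B, hB, hBW, hBM, Relation.ReflTransGen.single ⟨hAW, hBW, hA, hB, hd, hkA, hkB⟩⟩
    · obtain ⟨T', hT', hW, hTM', hr⟩ := ih hBM
      exact ⟨T', hT', hW, hTM', Relation.ReflTransGen.head
        ⟨hAW, hB.subset_compl_nbhdSet hM hBM, hA, hB, hd, hkA, hkB⟩ hr⟩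
end

section
/- Let G be a finite simple graph whose connected components have vertex sets C_1, …, C_s, let k be an integer, and let S, T be independent sets of G with |S ∩ C_i| = |T ∩ C_i| for every i ∈ {1,…,s}. If for every i ∈ {1,…,s} we have (S ∩ C_i) ↭_{k_i} (T ∩ C_i) in the induced subgraph G[C_i], where k_i = max(k − |S ∖ C_i|, 0), then S ↭_k T in G. -/
open Finset

variable {V : Type*}

theorem IndepF.mono_s15 {V : Type*} {G : SimpleGraph V} {A B : Finset V} (hB : IndepF G B)
    (h : A ⊆ B) : IndepF G A :=
  fun u hu v hv => hB u (h hu) v (h hv)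

/-- A set whose trace on each connected component is independent is independent. -/
theorem indepF_of_connectedComponent {V : Type*} {G : SimpleGraph V} {A : Finset V}
    (h : ∀ u ∈ A, ∀ v ∈ A, G.connectedComponentMk u = G.connectedComponentMk v → ¬ G.Adj u v) :
    IndepF G A :=
  fun u hu v hv huv =>
    h u hu v hv (SimpleGraph.ConnectedComponent.connectedComponentMk_eq_of_adj huv) huv

/-- A reconfiguration sequence inside a component `c` extends to `G` by adding a fixed
independent set `R` disjoint from `c`. -/
theorem TarReachOn.union_right {V : Type*} [DecidableEq V] {G : SimpleGraph V}
    {c : G.ConnectedComponent} {k l : ℤ} {R A B : Finset V} (hR : IndepF G R)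
    (hRc : ∀ x ∈ R, G.connectedComponentMk x ≠ c) (hk : k ≤ l + (R.card : ℤ))
    (h : TarReachOn G c.supp l A B) : TarReachOn G Set.univ k (A ∪ R) (B ∪ R) := by
  have indep : ∀ A : Finset V, (A : Set V) ⊆ c.supp → IndepF G A → IndepF G (A ∪ R) := by
    intro A hA hAi
    refine indepF_of_connectedComponent fun u hu v hv huv => ?_
    have hc : ∀ x ∈ A, G.connectedComponentMk x = c := fun x hx => hA hx
    rcases mem_union.1 hu with hu | hu <;> rcases mem_union.1 hv with hv | hv
    · exact hAi u hu v hv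
    · exact absurd (huv.symm.trans (hc u hu)) (hRc v hv)
    · exact absurd (huv.trans (hc v hv)) (hRc u hu)
    · exact hR u hu v hv
  have card : ∀ A : Finset V, (A : Set V) ⊆ c.supp → (A ∪ R).card = A.card + R.card := by
    intro A hA
    exact card_union_of_disjoint (disjoint_left.2 fun x hx hxR => hRc x hxR (hA hx))
  refine Relation.ReflTransGen.lift (· ∪ R) ?_ A B h
  rintro A B ⟨hA, hB, hAi, hBi, hAB, hlA, hlB⟩
  refine ⟨Set.subset_univ _, Set.subset_univ _, indep A hA hAi, indep B hB hBi,
    (card_le_card ?_).trans hAB, ?_, ?_⟩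
  · intro x
    simp only [mem_symmDiff, mem_union]
    tauto
  · rw [card A hA]; push_cast; linarith
  · rw [card B hB]; push_cast; linarith

open scoped Classical in
/-- The set agreeing with `T` on the components in `P` and with `S` on the others. -/
noncomputable def componentMix {V : Type*} [Fintype V] (G : SimpleGraph V) (S T : Finset V)
    (P : Finset G.ConnectedComponent) : Finset V :=
  univ.filter fun x => x ∈ if G.connectedComponentMk x ∈ P then T else S

theorem indepF_componentMix {V : Type*} [Fintype V] {G : SimpleGraph V} {S T : Finset V}
    (hS : IndepF G S) (hT : IndepF G T) (P : Finset G.ConnectedComponent) :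
    IndepF G (componentMix G S T P) := by
  refine indepF_of_connectedComponent fun u hu v hv huv => ?_
  simp only [componentMix, mem_filter, mem_univ, true_and] at hu hv
  by_cases hP : G.connectedComponentMk v ∈ P
  · rw [if_pos (huv ▸ hP)] at hu
    rw [if_pos hP] at hv
    exact hT u hu v hv
  · rw [if_neg (huv ▸ hP)] at hu
    rw [if_neg hP] at hv
    exact hS u hu v hv

open scoped Classical in
theorem card_filter_ne_component_congr {V : Type*} [Fintype V] {G : SimpleGraph V}
    {A B : Finset V}
    (h : ∀ c : G.ConnectedComponent,
      (A.filter (fun x => G.connectedComponentMk x = c)).card =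
        (B.filter (fun x => G.connectedComponentMk x = c)).card) (c : G.ConnectedComponent) :
    (A.filter (fun x => G.connectedComponentMk x ≠ c)).card =
      (B.filter (fun x => G.connectedComponentMk x ≠ c)).card := by
  have hAB : A.card = B.card := by
    rw [card_eq_sum_card_fiberwise (f := G.connectedComponentMk) (t := univ) (by simp),
      card_eq_sum_card_fiberwise (s := B) (f := G.connectedComponentMk) (t := univ) (by simp)]
    exact sum_congr rfl fun c _ => h c
  have hA := card_filter_add_card_filter_not (s := A) fun x => G.connectedComponentMk x = c
  have hB := card_filter_add_card_filter_not (s := B) fun x => G.connectedComponentMk x = c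
  have hc := h c
  simp only [ne_eq]
  omega

open scoped Classical in
/-- Let the connected components of `G` have vertex sets
`C_1, …, C_s`, let `k` be an integer, and let `S, T` be independent sets of
`G` with `|S ∩ C_i| = |T ∩ C_i|` for all `i`. If for every `i` we have
`(S ∩ C_i) ↭_{k_i} (T ∩ C_i)` in `G[C_i]`, where
`k_i = max(k - |S \ C_i|, 0)`, then `S ↭_k T` in `G`. -/
theorem stmt15 {V : Type*} [Fintype V] [DecidableEq V] (G : SimpleGraph V)
    (k : ℤ) (S T : Finset V) (hS : IndepF G S) (hT : IndepF G T)
    (hcard : ∀ c : G.ConnectedComponent,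
      (S.filter (fun x => G.connectedComponentMk x = c)).card =
        (T.filter (fun x => G.connectedComponentMk x = c)).card)
    (hreach : ∀ c : G.ConnectedComponent,
      TarReachOn G c.supp
        (max (k - ((S.filter (fun x => G.connectedComponentMk x ≠ c)).card : ℤ)) 0)
        (S.filter (fun x => G.connectedComponentMk x = c))
        (T.filter (fun x => G.connectedComponentMk x = c))) :
    TarReachOn G Set.univ k S T := by
  have hmix : ∀ (P : Finset G.ConnectedComponent) (c : G.ConnectedComponent),
      (componentMix G S T P).filter (fun x => G.connectedComponentMk x = c) =
        (if c ∈ P then T else S).filter (fun x => G.connectedComponentMk x = c) := by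
    intro P c
    ext x
    simp only [componentMix, mem_filter, mem_univ, true_and]
    refine and_congr_left fun hx => ?_
    rw [hx]
  have key : ∀ P : Finset G.ConnectedComponent,
      TarReachOn G Set.univ k S (componentMix G S T P) := by
    intro P
    induction P using Finset.induction_on with
    | empty =>
      have : componentMix G S T ∅ = S := by simp [componentMix]
      rw [this]
      exact Relation.ReflTransGen.refl
    | insert c P hc ih =>
      refine ih.trans ?_
      have hR := card_filter_ne_component_congr (A := componentMix G S T P) (B := S)
        (fun d => by
          rw [hmix]
          split_ifs
          · exact (hcard d).symm
          · rfl) c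
      have h := (hreach c).union_right (k := k)
        (R := (componentMix G S T P).filter (fun x => G.connectedComponentMk x ≠ c))
        ((indepF_componentMix hS hT P).mono_s15 (filter_subset _ _))
        (fun x hx => (mem_filter.1 hx).2)
        (by
          rw [hR]
          linarith [le_max_left
            (k - ((S.filter (fun x => G.connectedComponentMk x ≠ c)).card : ℤ)) 0])
      refine (congrArg₂ (TarReachOn G Set.univ k) ?_ ?_).mpr h
      · ext x
        by_cases hx : G.connectedComponentMk x = c <;> simp [componentMix, hx, hc]
      · ext x
        by_cases hx : G.connectedComponentMk x = c <;> simp [componentMix, hx]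
  have := key univ
  rwa [show componentMix G S T univ = T by simp [componentMix]] at this
end
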